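/- arXiv:1312.3955 — 2 statements merged into one kernel-verified Lean document; each statement's English description precedes it below -/
import Mathlib

section
/- For every n ≥ 1, the third central moment of the number of occurrences of the pattern 132 in a uniformly random permutation of S_n satisfies (1/n!)·∑_{π ∈ S_n} (N_{132}(π) − binom(n,3)/6)³ = n(n−1)(n−2)(129n⁴ + 3705n³ + 5355n² + 8655n + 11356)/12700800. -/
/-- The number of occurrences of the pattern `σ ∈ S_k` in the permutation `π ∈ S_n`. -/
def occ {k n : ℕ} (σ : Equiv.Perm (Fin k)) (π : Equiv.Perm (Fin n)) : ℕ :=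
  (Finset.univ.filter (fun f : Fin k → Fin n =>
    (∀ a b : Fin k, a < b → f a < f b) ∧
    (∀ a b : Fin k, π (f a) < π (f b) ↔ σ a < σ b))).card

/-- The pattern 123 (one-line notation), i.e. the identity of `S_3`. -/
def p123 : Equiv.Perm (Fin 3) := 1

/-- The pattern 132 (one-line notation). -/
def p132 : Equiv.Perm (Fin 3) := Equiv.swap 1 2

/-- The pattern 312 (one-line notation): 1 ↦ 3, 2 ↦ 1, 3 ↦ 2. -/
def p312 : Equiv.Perm (Fin 3) := ⟨![2, 0, 1], ![1, 2, 0], by decide, by decide⟩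

/-- The pattern 321 (one-line notation). -/
def p321 : Equiv.Perm (Fin 3) := Equiv.swap 0 2

open Finset

/-- The sum of `W` over all functions `ι → Fin j` that are surjective. -/
noncomputable def surjSum {ι : Type*} [Fintype ι] [DecidableEq ι]
    (W : ∀ n : ℕ, (ι → Fin n) → ℚ) (j : ℕ) : ℚ :=
  ∑ k : ι → Fin j with univ.image k = univ, W j k

theorem sum_image_eq_surjSum {ι : Type*} [Fintype ι] [DecidableEq ι]
    (W : ∀ n : ℕ, (ι → Fin n) → ℚ)
    (hW : ∀ (j n : ℕ) (e : Fin j ↪o Fin n) (k : ι → Fin j), W n (e ∘ k) = W j k)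
    {n : ℕ} (T : Finset (Fin n)) :
    ∑ k : ι → Fin n with univ.image k = T, W n k = surjSum W #T := by
  symm
  have hr : Set.range (T.orderEmbOfFin rfl) = T := T.range_orderEmbOfFin rfl
  refine sum_bij (fun k _ => T.orderEmbOfFin rfl ∘ k) ?_ ?_ ?_ ?_
  · intro k hk
    simp only [mem_filter, mem_univ, true_and] at hk ⊢
    rw [← image_image, hk]
    apply coe_injective
    simp
  · intro k _ k' _ h
    exact (T.orderEmbOfFin rfl).injective.comp_left h
  · intro k hk
    simp only [mem_filter, mem_univ, true_and] at hk
    have h : ∀ i, ∃ a, T.orderEmbOfFin rfl a = k i := fun i => by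
      have : k i ∈ Set.range (T.orderEmbOfFin rfl) := by
        rw [hr, ← hk]; simp
      exact this
    choose k' hk' using h
    have hc : T.orderEmbOfFin rfl ∘ k' = k := funext hk'
    refine ⟨k', ?_, hc⟩
    simp only [mem_filter, mem_univ, true_and]
    apply image_injective (T.orderEmbOfFin rfl).injective
    rw [image_image, hc, hk]
    apply coe_injective
    simp
  · intro k _
    rw [hW]

/-- A sum over all functions `ι → Fin n` of a weight which is invariant under order embeddings is a
linear combination of binomial coefficients in `n`. -/
theorem sum_functions_eq {ι : Type*} [Fintype ι] [DecidableEq ι]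
    (W : ∀ n : ℕ, (ι → Fin n) → ℚ)
    (hW : ∀ (j n : ℕ) (e : Fin j ↪o Fin n) (k : ι → Fin j), W n (e ∘ k) = W j k)
    (r : ℕ) (hr : ∀ j, r < j → ∀ k : ι → Fin j, univ.image k = univ → W j k = 0) (n : ℕ) :
    ∑ k, W n k = ∑ j ∈ range (r + 1), (n.choose j : ℚ) * surjSum W j := by
  have h0 : ∀ j, r < j → surjSum W j = 0 := fun j hj =>
    sum_eq_zero fun k hk => hr j hj k (by simpa using hk)
  calc ∑ k, W n k = ∑ T : Finset (Fin n), ∑ k : ι → Fin n with univ.image k = T, W n k :=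
        (sum_fiberwise _ _ _).symm
    _ = ∑ T ∈ (univ : Finset (Fin n)).powerset, surjSum W #T := by
        rw [powerset_univ]
        exact sum_congr rfl fun T _ => sum_image_eq_surjSum W hW T
    _ = ∑ j ∈ range (n + 1), (n.choose j : ℚ) * surjSum W j := by
        rw [sum_powerset_apply_card]; simp
    _ = ∑ j ∈ range (max n r + 1), (n.choose j : ℚ) * surjSum W j := by
        refine sum_subset (range_subset_range.2 (by omega)) fun j _ hj => ?_
        rw [Nat.choose_eq_zero_of_lt (by simpa using hj)]; simp
    _ = ∑ j ∈ range (r + 1), (n.choose j : ℚ) * surjSum W j := by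
        refine (sum_subset (range_subset_range.2 (by omega)) fun j _ hj => ?_).symm
        rw [h0 j (by simpa using hj), mul_zero]

/-- The number of pairs `b, x` of entries of the list, `b` before `x`, with `a < x < b`. -/
def invAbove (a : ℕ) : List ℕ → ℕ
  | [] => 0
  | b :: l => (if a < b then l.countP (fun x => a < x ∧ x < b) else 0) + invAbove a l

/-- The number of occurrences of the pattern 132 in a list. -/
def count132 : List ℕ → ℕ
  | [] => 0
  | a :: l => invAbove a l + count132 l

theorem countP_ofFn {α : Type*} (p : α → Bool) {n : ℕ} (v : Fin n → α) :
    (List.ofFn v).countP p = ∑ i, if p (v i) then 1 else 0 := by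
  induction n with
  | zero => simp
  | succ n ih => rw [List.ofFn_succ, List.countP_cons, ih, Fin.sum_univ_succ, add_comm]

theorem invAbove_ofFn (a : ℕ) {n : ℕ} (v : Fin n → ℕ) :
    invAbove a (List.ofFn v) =
      ∑ j, ∑ k, if j < k ∧ a < v k ∧ v k < v j then 1 else 0 := by
  induction n with
  | zero => simp [invAbove]
  | succ n ih =>
    rw [List.ofFn_succ, invAbove, ih, countP_ofFn, Fin.sum_univ_succ]
    simp only [Fin.sum_univ_succ, Fin.succ_lt_succ_iff]
    congr 1
    · by_cases h : a < v 0
      · simp [h]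
      · simp only [h, if_false]
        symm
        simp only [lt_irrefl, false_and, if_false, zero_add]
        exact sum_eq_zero fun k _ => if_neg (by omega)
    · simp

theorem count132_ofFn {n : ℕ} (v : Fin n → ℕ) :
    count132 (List.ofFn v) =
      ∑ i, ∑ j, ∑ k, if i < j ∧ j < k ∧ v i < v k ∧ v k < v j then 1 else 0 := by
  induction n with
  | zero => simp [count132]
  | succ n ih =>
    rw [List.ofFn_succ, count132, ih, invAbove_ofFn, Fin.sum_univ_succ]
    simp [Fin.sum_univ_succ, -sum_boole]

/-- Triples, seen as functions on `Fin 3`. -/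
def finThreeArrowEquiv (α : Type*) : (Fin 3 → α) ≃ α × α × α where
  toFun f := (f 0, f 1, f 2)
  invFun p := ![p.1, p.2.1, p.2.2]
  left_inv f := by ext i; fin_cases i <;> rfl
  right_inv _ := rfl

theorem occ_p132_eq_count132 {n : ℕ} (π : Equiv.Perm (Fin n)) :
    occ p132 π = count132 (List.ofFn fun i => (π i : ℕ)) := by
  rw [count132_ofFn, occ, card_filter, ← (finThreeArrowEquiv (Fin n)).symm.sum_comp,
    Fintype.sum_prod_type]
  simp_rw [Fintype.sum_prod_type]
  refine sum_congr rfl fun i _ => sum_congr rfl fun j _ => sum_congr rfl fun k _ =>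
    if_congr ?_ rfl rfl
  have h0 : p132 0 = 0 := by decide
  have h1 : p132 1 = 2 := by decide
  have h2 : p132 2 = 1 := by decide
  have hf : (finThreeArrowEquiv (Fin n)).symm (i, j, k) = ![i, j, k] := rfl
  rw [hf]
  simp [Fin.forall_fin_succ, h1, h2, h0]
  omega

theorem sum_perm_eq_sum_permutations' {M : Type*} [AddCommMonoid M] (n : ℕ) (g : List ℕ → M) :
    ∑ π : Equiv.Perm (Fin n), g (List.ofFn fun i => (π i : ℕ)) =
      ((List.range n).permutations'.map g).sum := by
  have hinj : Function.Injective fun π : Equiv.Perm (Fin n) => List.ofFn fun i => (π i : ℕ) := by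
    intro π ρ h
    ext i
    exact congrFun (List.ofFn_injective h) i
  have hnd : (List.range n).permutations'.Nodup :=
    (List.permutations_perm_permutations' _).nodup_iff.1
      (List.nodup_permutations _ List.nodup_range)
  have himg : univ.image (fun π : Equiv.Perm (Fin n) => List.ofFn fun i => (π i : ℕ)) =
      (List.range n).permutations'.toFinset := by
    apply eq_of_subset_of_card_le
    · intro l hl
      obtain ⟨π, -, rfl⟩ := mem_image.1 hl
      rw [List.mem_toFinset, List.mem_permutations']
      have := π.ofFn_comp_perm (fun i : Fin n => (i : ℕ))
      rwa [List.ofFn_eq_map (f := fun i : Fin n => (i : ℕ)), List.map_coe_finRange_eq_range] at this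
    · rw [card_image_of_injective _ hinj, List.toFinset_card_of_nodup hnd,
        ← (List.permutations_perm_permutations' _).length_eq, List.length_permutations]
      simp [Fintype.card_perm]
  rw [← List.sum_toFinset _ hnd, ← himg, sum_image hinj.injOn]

/-- The sum of `g` over all permutations of the list. -/
def permSum : List ℕ → (List ℕ → ℤ) → ℤ
  | [], g => g []
  | t :: ts, g => permSum ts fun l => ((List.permutations'Aux t l).map g).sum

theorem permSum_eq (l : List ℕ) (g : List ℕ → ℤ) :
    permSum l g = (l.permutations'.map g).sum := by
  induction l generalizing g with
  | nil => simp [permSum]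
  | cons t ts ih =>
    rw [permSum, ih, List.permutations', List.map_flatMap, List.flatMap_def, List.sum_flatten,
      List.map_map]
    rfl

/-- The centred indicator that the entries of `v` at the positions `f` form the pattern 132; it is
zero if `f` does not list its positions in increasing order. -/
noncomputable def excess {n m : ℕ} (f : Fin 3 → Fin n) (v : Fin n → Fin m) : ℚ :=
  if StrictMono f then
    (if ∀ a b, v (f a) < v (f b) ↔ p132 a < p132 b then 1 else 0) - 1 / 6
  else 0

theorem excess_congr {n m m' : ℕ} (f : Fin 3 → Fin n) {v : Fin n → Fin m} {w : Fin n → Fin m'}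
    (h : ∀ a b, v a < v b ↔ w a < w b) : excess f v = excess f w := by
  simp only [excess, h]

theorem excess_comp {j n m : ℕ} (e : Fin j ↪o Fin n) (f : Fin 3 → Fin j) (v : Fin n → Fin m) :
    excess (e ∘ f) v = excess f (v ∘ e) := by
  have h : StrictMono (e ∘ f) ↔ StrictMono f := by simp [StrictMono]
  simp only [excess, h, Function.comp_apply]

/-- The standardization of an injective word. -/
theorem exists_perm_lt_iff {j m : ℕ} (v : Fin j → Fin m) (hv : Function.Injective v) :
    ∃ ρ : Equiv.Perm (Fin j), ∀ a b, v a < v b ↔ ρ a < ρ b := by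
  have hs : StrictMono (v ∘ Tuple.sort v) :=
    (Tuple.monotone_sort v).strictMono_of_injective (hv.comp (Tuple.sort v).injective)
  refine ⟨(Tuple.sort v)⁻¹, fun a b => ?_⟩
  rw [← hs.lt_iff_lt]
  simp

theorem excess_one_perm_sum : ∑ τ : Equiv.Perm (Fin 3), excess id τ = 0 := by
  have h : ∀ τ : Equiv.Perm (Fin 3), (∀ a b, τ (id a) < τ (id b) ↔ p132 a < p132 b) ↔ τ = p132 := by
    decide
  simp only [excess, strictMono_id, if_true, h]
  simp [Fintype.card_perm, Nat.factorial]

theorem sum_excess_perm {m : ℕ} (v : Fin 3 → Fin m) (hv : Function.Injective v) :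
    ∑ τ : Equiv.Perm (Fin 3), excess id (v ∘ τ) = 0 := by
  obtain ⟨ρ, hρ⟩ := exists_perm_lt_iff v hv
  rw [← excess_one_perm_sum]
  exact Fintype.sum_equiv (Equiv.mulLeft ρ) _ _ fun τ => excess_congr _ fun a b => hρ _ _

/-- Averaging over the permutations of the positions in the range of `e`. -/
theorem sum_perm_eq_sum_viaFintypeEmbedding {j n : ℕ} (e : Fin j ↪ Fin n)
    (G : Equiv.Perm (Fin n) → ℚ) :
    (j.factorial : ℚ) * ∑ π, G π =
      ∑ π, ∑ τ : Equiv.Perm (Fin j), G (π * τ.viaFintypeEmbedding e) := by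
  rw [sum_comm]
  have h : ∀ τ : Equiv.Perm (Fin j), ∑ π, G (π * τ.viaFintypeEmbedding e) = ∑ π, G π := fun τ =>
    Equiv.sum_comp (Equiv.mulRight (τ.viaFintypeEmbedding e)) G
  simp [h, Fintype.card_perm]

theorem sum_excess_mul_eq_zero {n : ℕ} (f : Fin 3 → Fin n) (H : Equiv.Perm (Fin n) → ℚ)
    (hH : ∀ π ρ : Equiv.Perm (Fin n), (∀ i, i ∉ Set.range f → π i = ρ i) → H π = H ρ) :
    ∑ π : Equiv.Perm (Fin n), excess f π * H π = 0 := by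
  by_cases hf : StrictMono f
  swap
  · simp [excess, hf]
  let e : Fin 3 ↪ Fin n := ⟨f, hf.injective⟩
  have key := sum_perm_eq_sum_viaFintypeEmbedding e fun π => excess f π * H π
  have h0 : ∀ π : Equiv.Perm (Fin n),
      ∑ τ : Equiv.Perm (Fin 3), excess f (π * τ.viaFintypeEmbedding e : Equiv.Perm (Fin n)) *
        H (π * τ.viaFintypeEmbedding e) = 0 := fun π => by
    have h1 : ∀ τ : Equiv.Perm (Fin 3), H (π * τ.viaFintypeEmbedding e) = H π := fun τ =>
      hH _ _ fun i hi => by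
        rw [Equiv.Perm.mul_apply, Equiv.Perm.viaFintypeEmbedding_apply_notMem_range _ _ hi]
    have h2 : ∀ τ : Equiv.Perm (Fin 3),
        excess f (π * τ.viaFintypeEmbedding e : Equiv.Perm (Fin n)) =
          excess id ((π ∘ f) ∘ τ) := fun τ => by
      have := excess_comp (OrderEmbedding.ofStrictMono f hf) id
        (π * τ.viaFintypeEmbedding e : Equiv.Perm (Fin n))
      refine this.trans (congrArg _ (funext fun a => ?_))
      exact congrArg π (Equiv.Perm.viaFintypeEmbedding_apply_image τ e a)
    simp only [h1, h2, ← sum_mul]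
    rw [sum_excess_perm _ (π.injective.comp hf.injective), zero_mul]
  simp only [h0, sum_const_zero] at key
  simpa [Nat.factorial] using key

/-- The row `i` of a word indexed by `Fin 3 × Fin 3`. -/
def row {α : Type*} (k : Fin 3 × Fin 3 → α) (i : Fin 3) : Fin 3 → α := fun a => k (i, a)

/-- The mixed central moment of the occurrence indicators at the three rows of `k`. -/
noncomputable def mixedMoment (n : ℕ) (k : Fin 3 × Fin 3 → Fin n) : ℚ :=
  1 / (n.factorial : ℚ) * ∑ π : Equiv.Perm (Fin n), ∏ i, excess (row k i) π

theorem mixedMoment_comp (j n : ℕ) (e : Fin j ↪o Fin n) (k : Fin 3 × Fin 3 → Fin j) :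
    mixedMoment n (e ∘ k) = mixedMoment j k := by
  have key := sum_perm_eq_sum_viaFintypeEmbedding e.toEmbedding
    fun π => ∏ i, excess (row (e ∘ k) i) π
  have h0 : ∀ π : Equiv.Perm (Fin n), ∑ τ : Equiv.Perm (Fin j), ∏ i, excess (row (e ∘ k) i)
      (π * τ.viaFintypeEmbedding e.toEmbedding : Equiv.Perm (Fin n)) =
        ∑ τ : Equiv.Perm (Fin j), ∏ i, excess (row k i) τ := fun π => by
    obtain ⟨ρ, hρ⟩ := exists_perm_lt_iff (π ∘ e) (π.injective.comp e.injective)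
    refine Fintype.sum_equiv (Equiv.mulLeft ρ) _ _ fun τ => prod_congr rfl fun i _ => ?_
    refine (excess_comp e (row k i) _).trans (excess_congr _ fun a b => ?_)
    have h1 : ∀ a, (π * τ.viaFintypeEmbedding e.toEmbedding : Equiv.Perm (Fin n)) (e a) =
        π (e (τ a)) := fun a =>
      congrArg π (Equiv.Perm.viaFintypeEmbedding_apply_image τ e.toEmbedding a)
    simp only [Function.comp_apply, h1]
    exact hρ _ _
  simp only [h0, sum_const, card_univ, Fintype.card_perm, Fintype.card_fin, nsmul_eq_mul] at key
  have hj : (j.factorial : ℚ) ≠ 0 := by positivity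
  have hn : (n.factorial : ℚ) ≠ 0 := by positivity
  rw [mixedMoment, mixedMoment]
  field_simp
  linarith

theorem excess_congr_of_eqOn {n m : ℕ} (f : Fin 3 → Fin n) {v w : Fin n → Fin m}
    (h : ∀ a, v (f a) = w (f a)) : excess f v = excess f w := by
  simp only [excess, h]

theorem mixedMoment_eq_zero_of_disjoint {n : ℕ} (k : Fin 3 × Fin 3 → Fin n) (i : Fin 3)
    (hi : ∀ i', i' ≠ i → Disjoint (univ.image (row k i)) (univ.image (row k i'))) :
    mixedMoment n k = 0 := by
  have hp : ∀ π : Equiv.Perm (Fin n), ∏ i', excess (row k i') π =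
      excess (row k i) π * ∏ i' ∈ univ.erase i, excess (row k i') π := fun π =>
    (mul_prod_erase univ _ (mem_univ i)).symm
  simp only [mixedMoment, hp]
  rw [sum_excess_mul_eq_zero (row k i) fun π => ∏ i' ∈ univ.erase i, excess (row k i') π, mul_zero]
  refine fun π ρ h => prod_congr rfl fun i' hi' => excess_congr_of_eqOn _ fun a => h _ ?_
  rintro ⟨b, hb⟩
  exact disjoint_left.1 (hi i' (ne_of_mem_erase hi')) (mem_image_of_mem _ (mem_univ b))
    (hb ▸ mem_image_of_mem _ (mem_univ a))

theorem card_union_le_of_not_disjoint {α : Type*} [DecidableEq α] {A B C : Finset α}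
    (hA : #A ≤ 3) (hB : #B ≤ 3) (hC : #C ≤ 3) (hAB : ¬Disjoint A B)
    (h : ¬(Disjoint C A ∧ Disjoint C B)) : #(A ∪ B ∪ C) ≤ 7 := by
  have h1 : 0 < #(A ∩ B) := card_pos.2 (not_disjoint_iff_nonempty_inter.1 hAB)
  have h2 : 0 < #((A ∪ B) ∩ C) := by
    refine card_pos.2 (not_disjoint_iff_nonempty_inter.1 fun h' => h ?_)
    rwa [disjoint_union_left, disjoint_comm, disjoint_comm (a := B)] at h'
  have := card_union_add_card_inter A B
  have := card_union_add_card_inter (A ∪ B) C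
  omega

theorem mixedMoment_eq_zero_of_surjective (j : ℕ) (hj : 7 < j) (k : Fin 3 × Fin 3 → Fin j)
    (hk : univ.image k = univ) : mixedMoment j k = 0 := by
  by_contra h0
  have hd : ∀ i, ¬∀ i', i' ≠ i → Disjoint (univ.image (row k i)) (univ.image (row k i')) :=
    fun i hi => h0 (mixedMoment_eq_zero_of_disjoint k i hi)
  set R : Fin 3 → Finset (Fin j) := fun i => univ.image (row k i) with hR
  have hc : ∀ i, #(R i) ≤ 3 := fun i => card_image_le
  have hu : R 0 ∪ R 1 ∪ R 2 = univ := by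
    refine eq_univ_iff_forall.2 fun x => ?_
    obtain ⟨⟨i, a⟩, -, rfl⟩ := mem_image.1 (hk ▸ mem_univ x : x ∈ univ.image k)
    have : k (i, a) ∈ R i := mem_image_of_mem (row k i) (mem_univ a)
    fin_cases i <;> simp_all
  have h7 : ¬#(R 0 ∪ R 1 ∪ R 2) ≤ 7 := by rw [hu]; simpa using hj
  have d0 : ¬(Disjoint (R 0) (R 1) ∧ Disjoint (R 0) (R 2)) := fun h =>
    hd 0 fun i hi => by fin_cases i <;> first | exact absurd rfl hi | exact h.1 | exact h.2
  have d1 : ¬(Disjoint (R 1) (R 0) ∧ Disjoint (R 1) (R 2)) := fun h =>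
    hd 1 fun i hi => by fin_cases i <;> first | exact absurd rfl hi | exact h.1 | exact h.2
  have d2 : ¬(Disjoint (R 2) (R 0) ∧ Disjoint (R 2) (R 1)) := fun h =>
    hd 2 fun i hi => by fin_cases i <;> first | exact absurd rfl hi | exact h.1 | exact h.2
  by_cases h01 : Disjoint (R 0) (R 1)
  · have h02 : ¬Disjoint (R 0) (R 2) := fun h => d0 ⟨h01, h⟩
    apply h7
    rw [union_right_comm]
    exact card_union_le_of_not_disjoint (hc 0) (hc 2) (hc 1) h02 d1
  · exact h7 (card_union_le_of_not_disjoint (hc 0) (hc 1) (hc 2) h01 d2)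

theorem sum_boole_strictMono (n : ℕ) :
    ∑ f : Fin 3 → Fin n, (if StrictMono f then (1 : ℚ) else 0) = n.choose 3 := by
  have hW : ∀ (j n : ℕ) (e : Fin j ↪o Fin n) (f : Fin 3 → Fin j),
      (if StrictMono (e ∘ f) then (1 : ℚ) else 0) = if StrictMono f then 1 else 0 :=
    fun j n e f => by simp [StrictMono]
  have hr : ∀ j, 3 < j → ∀ f : Fin 3 → Fin j, univ.image f = univ →
      (if StrictMono f then (1 : ℚ) else 0) = 0 := fun j hj f hf => by
    have := card_image_le (s := univ) (f := f)
    rw [hf] at this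
    simp at this
    omega
  have hd : ∀ j : ℕ, surjSum (fun n (f : Fin 3 → Fin n) => if StrictMono f then (1 : ℚ) else 0) j =
      #{f : Fin 3 → Fin j | univ.image f = univ ∧ ∀ a b, a < b → f a < f b} := fun j => by
    rw [surjSum, sum_boole, filter_filter]
    rfl
  rw [sum_functions_eq (fun n f => if StrictMono f then (1 : ℚ) else 0) hW 3 hr n]
  have c0 : #{f : Fin 3 → Fin 0 | univ.image f = univ ∧ ∀ a b, a < b → f a < f b} = 0 := by decide
  have c1 : #{f : Fin 3 → Fin 1 | univ.image f = univ ∧ ∀ a b, a < b → f a < f b} = 0 := by decide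
  have c2 : #{f : Fin 3 → Fin 2 | univ.image f = univ ∧ ∀ a b, a < b → f a < f b} = 0 := by decide
  have c3 : #{f : Fin 3 → Fin 3 | univ.image f = univ ∧ ∀ a b, a < b → f a < f b} = 1 := by decide
  simp only [sum_range_succ, sum_range_zero, hd, c0, c1, c2, c3]
  simp

theorem sum_excess {n : ℕ} (π : Equiv.Perm (Fin n)) :
    ∑ f : Fin 3 → Fin n, excess f π = occ p132 π - n.choose 3 / 6 := by
  rw [← sum_boole_strictMono, occ, card_filter, Nat.cast_sum, sum_div, ← sum_sub_distrib]
  refine sum_congr rfl fun f _ => ?_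
  have hf : (∀ a b, a < b → f a < f b) ↔ StrictMono f := Iff.rfl
  by_cases h : StrictMono f <;> simp [excess, hf, h]

/-- The third central moment of the number of occurrences of 132. -/
noncomputable def centralMoment (n : ℕ) : ℚ :=
  1 / (n.factorial : ℚ) * ∑ π : Equiv.Perm (Fin n), ((occ p132 π : ℚ) - (n.choose 3 : ℚ) / 6) ^ 3

theorem centralMoment_eq_sum_mixedMoment (n : ℕ) :
    centralMoment n = ∑ k, mixedMoment n k := by
  simp only [mixedMoment]
  rw [centralMoment, ← mul_sum, sum_comm]
  congr 1
  refine sum_congr rfl fun π _ => ?_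
  rw [← sum_excess, Fintype.sum_pow, ← (Equiv.curry (Fin 3) (Fin 3) (Fin n)).sum_comp]
  rfl

theorem centralMoment_eq_sum_choose (n : ℕ) :
    centralMoment n = ∑ j ∈ range 8, (n.choose j : ℚ) * surjSum mixedMoment j := by
  rw [centralMoment_eq_sum_mixedMoment]
  exact sum_functions_eq mixedMoment mixedMoment_comp 7 mixedMoment_eq_zero_of_surjective n

theorem centralMoment_eq_permSum (n : ℕ) :
    centralMoment n = (permSum (List.range n)
      fun l => (6 * (count132 l : ℤ) - n.choose 3) ^ 3 : ℤ) / (216 * n.factorial) := by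
  have h : ∀ π : Equiv.Perm (Fin n), ((occ p132 π : ℚ) - (n.choose 3 : ℚ) / 6) ^ 3 =
      ((6 * (count132 (List.ofFn fun i => (π i : ℕ)) : ℤ) - n.choose 3) ^ 3 : ℤ) / 216 := fun π => by
    rw [occ_p132_eq_count132]
    push_cast
    ring
  rw [permSum_eq, ← sum_perm_eq_sum_permutations' n
    fun l => (6 * (count132 l : ℤ) - n.choose 3) ^ 3, centralMoment, sum_congr rfl fun π _ => h π,
    ← sum_div, ← Int.cast_sum]
  field_simp

theorem centralMoment_values : centralMoment 0 = 0 ∧ centralMoment 1 = 0 ∧ centralMoment 2 = 0 ∧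
    centralMoment 3 = 120 / (216 * 6) ∧ centralMoment 4 = 3936 / (216 * 24) ∧
    centralMoment 5 = 89664 / (216 * 120) ∧ centralMoment 6 = 1797840 / (216 * 720) ∧
    centralMoment 7 = 34467840 / (216 * 5040) := by
  have h : ∀ (n : ℕ) (s : ℤ), permSum (List.range n)
      (fun l => (6 * (count132 l : ℤ) - n.choose 3) ^ 3) = s →
        centralMoment n = s / (216 * n.factorial) := fun n s hs => by
    rw [centralMoment_eq_permSum, hs]
  refine ⟨(h 0 0 ?_).trans ?_, (h 1 0 ?_).trans ?_, (h 2 0 ?_).trans ?_, (h 3 120 ?_).trans ?_,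
    (h 4 3936 ?_).trans ?_, (h 5 89664 ?_).trans ?_, (h 6 1797840 ?_).trans ?_,
    (h 7 34467840 ?_).trans ?_⟩
  all_goals decide +kernel

theorem stmt4 (n : ℕ) (hn : 1 ≤ n) :
    (1 / (n.factorial : ℚ)) * ∑ π : Equiv.Perm (Fin n),
        ((occ p132 π : ℚ) - (n.choose 3 : ℚ) / 6) ^ 3
      = (n : ℚ) * ((n : ℚ) - 1) * ((n : ℚ) - 2)
        * (129 * (n : ℚ) ^ 4 + 3705 * (n : ℚ) ^ 3 + 5355 * (n : ℚ) ^ 2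
            + 8655 * (n : ℚ) + 11356) / 12700800 := by
  change centralMoment n = _
  have hP := centralMoment_eq_sum_choose
  obtain ⟨h0, h1, h2, h3, h4, h5, h6, h7⟩ := centralMoment_values
  rw [hP] at h0 h1 h2 h3 h4 h5 h6 h7 ⊢
  generalize surjSum mixedMoment = d at *
  have hc : ∀ j, (n.choose (j + 1) : ℚ) = n.choose j * (n - j) / (j + 1) := fun j => by
    rw [eq_div_iff (by positivity)]
    rcases le_or_gt j n with h | h
    · have := Nat.choose_succ_right_eq n j
      rw [← Nat.cast_sub h]
      exact_mod_cast this
    · simp [Nat.choose_eq_zero_of_lt h, Nat.choose_eq_zero_of_lt (h.trans (Nat.lt_succ_self j))]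
  norm_num [sum_range_succ, Nat.choose] at h0 h1 h2 h3 h4 h5 h6 h7
  have d0 : d 0 = 0 := by linarith
  have d1 : d 1 = 0 := by linarith
  have d2 : d 2 = 0 := by linarith
  have d3 : d 3 = 5/54 := by linarith
  have d4 : d 4 = 7/18 := by linarith
  have d5 : d 5 = 53/90 := by linarith
  have d6 : d 6 = 41/120 := by linarith
  have d7 : d 7 = 43/840 := by linarith
  simp only [sum_range_succ, sum_range_zero, hc, Nat.choose_zero_right, d0, d1, d2, d3, d4, d5, d6,
    d7]
  push_cast
  ring
end

section
/- For every n ≥ 1, the covariance of the numbers of occurrences of the patterns 123 and 132 in a uniformly random permutation of S_n satisfies (1/n!)·∑_{π ∈ S_n} (N_{123}(π) − binom(n,3)/6)(N_{132}(π) − binom(n,3)/6) = n(n−1)(n−2)(18n² − 51n − 109)/21600. -/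
theorem exists_perm_lt_iff_lt {m n : ℕ} {v : Fin m → Fin n} (hv : Function.Injective v) :
    ∃ ρ : Equiv.Perm (Fin m), ∀ a b, v a < v b ↔ ρ a < ρ b := by
  have hs : StrictMono (v ∘ Tuple.sort v) :=
    (Tuple.monotone_sort v).strictMono_of_injective (hv.comp (Tuple.sort v).injective)
  refine ⟨(Tuple.sort v)⁻¹, fun a b => ?_⟩
  rw [← hs.lt_iff_lt]
  simp

theorem sum_perm_lt_comp {m n : ℕ} {v : Fin m → Fin n} (hv : Function.Injective v)
    (B : (Fin m → Fin m → Prop) → ℚ) :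
    ∑ s : Equiv.Perm (Fin m), B (fun a b => v (s a) < v (s b)) =
      ∑ s : Equiv.Perm (Fin m), B (fun a b => s a < s b) := by
  obtain ⟨ρ, hρ⟩ := exists_perm_lt_iff_lt hv
  rw [← Equiv.sum_comp (Equiv.mulLeft ρ) (fun s : Equiv.Perm (Fin m) => B fun a b => s a < s b)]
  simp [hρ]

/-- The relative order of a uniform permutation on `m` fixed positions is uniform in `S_m`. -/
theorem factorial_mul_sum_perm_lt {m n : ℕ} (h : Fin m ↪ Fin n)
    (B : (Fin m → Fin m → Prop) → ℚ) :
    (m.factorial : ℚ) * ∑ π : Equiv.Perm (Fin n), B (fun a b => π (h a) < π (h b)) =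
      n.factorial * ∑ s : Equiv.Perm (Fin m), B (fun a b => s a < s b) := by
  have key (s : Equiv.Perm (Fin m)) :
      ∑ π : Equiv.Perm (Fin n), B (fun a b => π (h a) < π (h b)) =
        ∑ π : Equiv.Perm (Fin n), B (fun a b => π (h (s a)) < π (h (s b))) := by
    rw [← Equiv.sum_comp (Equiv.mulRight (s.viaFintypeEmbedding h))
      (fun π : Equiv.Perm (Fin n) => B fun a b => π (h a) < π (h b))]
    simp
  calc (m.factorial : ℚ) * ∑ π : Equiv.Perm (Fin n), B (fun a b => π (h a) < π (h b))
      = ∑ s : Equiv.Perm (Fin m), ∑ π : Equiv.Perm (Fin n),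
          B (fun a b => π (h (s a)) < π (h (s b))) := by
        simp [← key, Fintype.card_perm]
    _ = ∑ π : Equiv.Perm (Fin n), ∑ s : Equiv.Perm (Fin m), B (fun a b => s a < s b) := by
        rw [Finset.sum_comm]
        exact Finset.sum_congr rfl fun π _ =>
          sum_perm_lt_comp (π.injective.comp h.injective) B
    _ = _ := by simp [Fintype.card_perm]

open Finset in
/-- A statistic of `π ∈ S_n` summed over all `ι`-tuples of positions, depending only on the
relative orders of the positions and of the values, has mean a combination of
`n.choose m`, `m ≤ |ι|`, with coefficients that do not depend on `n`. -/
theorem exists_choose_expansion {ι : Type*} [Fintype ι] [DecidableEq ι]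
    (A : (ι → ι → Prop) → (ι → ι → Prop) → ℚ) :
    ∃ c : ℕ → ℚ, ∀ n : ℕ,
      ∑ π : Equiv.Perm (Fin n), ∑ F : ι → Fin n,
          A (fun a b => F a < F b) (fun a b => π (F a) < π (F b)) =
        n.factorial * ∑ m ∈ range (Fintype.card ι + 1), (n.choose m : ℚ) * c m := by
  let c : ℕ → ℚ := fun m => (m.factorial : ℚ)⁻¹ *
    ∑ F : ι → Fin m with univ.image F = univ, ∑ ρ : Equiv.Perm (Fin m),
      A (fun a b => F a < F b) (fun a b => ρ (F a) < ρ (F b))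
  have hc (m : ℕ) (hm : Fintype.card ι < m) : c m = 0 := by
    have : (univ.filter fun F : ι → Fin m => univ.image F = univ) = ∅ := by
      refine filter_eq_empty_iff.2 fun F _ hF => ?_
      have := card_image_le (s := univ) (f := F)
      rw [hF, card_univ, card_univ, Fintype.card_fin] at this
      omega
    simp [c, this]
  refine ⟨c, fun n => ?_⟩
  have hU (U : Finset (Fin n)) :
      ∑ F : ι → Fin n with univ.image F = U, ∑ π : Equiv.Perm (Fin n),
        A (fun a b => F a < F b) (fun a b => π (F a) < π (F b)) =
      n.factorial * c #U := by
    set h := U.orderEmbOfFin rfl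
    have hF (F : ι → Fin #U) :
        ∑ π : Equiv.Perm (Fin n),
          A (fun a b => h (F a) < h (F b)) (fun a b => π (h (F a)) < π (h (F b))) =
        n.factorial * ((#U).factorial : ℚ)⁻¹ * ∑ ρ : Equiv.Perm (Fin #U),
          A (fun a b => F a < F b) (fun a b => ρ (F a) < ρ (F b)) := by
      have := factorial_mul_sum_perm_lt h.toEmbedding
        (fun r => A (fun a b => F a < F b) (fun a b => r (F a) (F b)))
      have h0 : ((#U).factorial : ℚ) ≠ 0 := by positivity
      simp only [OrderEmbedding.lt_iff_lt]
      field_simp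
      rw [mul_comm]
      simpa using this
    have : c #U = ∑ F : ι → Fin #U with univ.image F = univ, ((#U).factorial : ℚ)⁻¹ *
        ∑ ρ : Equiv.Perm (Fin #U), A (fun a b => F a < F b) (fun a b => ρ (F a) < ρ (F b)) :=
      mul_sum _ _ _
    rw [this, mul_sum]
    symm
    refine sum_bij (fun F _ => h ∘ F) ?_ ?_ ?_ ?_
    · intro F hF
      rw [mem_filter] at hF ⊢
      refine ⟨mem_univ _, ?_⟩
      rw [← image_image, hF.2]
      exact image_orderEmbOfFin_univ U rfl
    · intro F _ G _ hFG
      exact h.injective.comp_left hFG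
    · intro G hG
      rw [mem_filter] at hG
      have hr (a : ι) : ∃ b, h b = G a := by
        have : G a ∈ Set.range h := by
          rw [range_orderEmbOfFin, ← hG.2]
          simp
        exact this
      choose F hF using hr
      have hFG : h ∘ F = G := funext hF
      refine ⟨F, ?_, hFG⟩
      rw [mem_filter]
      refine ⟨mem_univ _, image_injective h.injective ?_⟩
      rw [image_image, hFG, hG.2]
      exact (image_orderEmbOfFin_univ U rfl).symm
    · intro F _
      rw [← mul_assoc]
      exact (hF F).symm
  rw [sum_comm, ← sum_fiberwise_of_maps_to
    (t := (univ : Finset (Fin n)).powerset) (g := fun F : ι → Fin n => univ.image F)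
    (fun F _ => mem_powerset.2 (subset_univ _))]
  simp only [hU]
  rw [← mul_sum, sum_powerset_apply_card]
  congr 1
  simp only [card_univ, Fintype.card_fin, nsmul_eq_mul]
  rcases le_total n (Fintype.card ι) with hle | hle
  · refine sum_subset (range_mono (by omega)) fun m _ hm => ?_
    rw [Nat.choose_eq_zero_of_lt (by simpa using hm)]
    simp
  · refine (sum_subset (range_mono (by omega)) fun m _ hm => ?_).symm
    rw [hc m (by simpa using hm), mul_zero]

theorem occ_eq_sum {k n : ℕ} (σ : Equiv.Perm (Fin k)) (π : Equiv.Perm (Fin n)) :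
    occ σ π = ∑ f : Fin k → Fin n,
      if (∀ a b : Fin k, a < b → f a < f b) ∧ (∀ a b : Fin k, π (f a) < π (f b) ↔ σ a < σ b)
      then 1 else 0 :=
  Finset.card_filter _ _

open Classical in
theorem exists_choose_expansion_occ {k : ℕ} (σ : Equiv.Perm (Fin k)) :
    ∃ c : ℕ → ℚ, ∀ n : ℕ, ∑ π : Equiv.Perm (Fin n), (occ σ π : ℚ) =
      n.factorial * ∑ m ∈ Finset.range (k + 1), (n.choose m : ℚ) * c m := by
  obtain ⟨c, hc⟩ := exists_choose_expansion (ι := Fin k) fun r s =>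
    if (∀ a b : Fin k, a < b → r a b) ∧ (∀ a b : Fin k, s a b ↔ σ a < σ b) then 1 else 0
  refine ⟨c, fun n => ?_⟩
  rw [Fintype.card_fin] at hc
  rw [← hc]
  refine Finset.sum_congr rfl fun π _ => ?_
  rw [occ_eq_sum]
  push_cast
  exact Finset.sum_congr rfl fun f _ => by congr

open Classical in
theorem exists_choose_expansion_occ_mul_occ {k l : ℕ} (σ : Equiv.Perm (Fin k))
    (τ : Equiv.Perm (Fin l)) :
    ∃ c : ℕ → ℚ, ∀ n : ℕ, ∑ π : Equiv.Perm (Fin n), (occ σ π : ℚ) * occ τ π =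
      n.factorial * ∑ m ∈ Finset.range (k + l + 1), (n.choose m : ℚ) * c m := by
  obtain ⟨c, hc⟩ := exists_choose_expansion (ι := Fin k ⊕ Fin l) fun r s =>
    (if (∀ a b : Fin k, a < b → r (.inl a) (.inl b)) ∧
      (∀ a b : Fin k, s (.inl a) (.inl b) ↔ σ a < σ b) then 1 else 0) *
    (if (∀ a b : Fin l, a < b → r (.inr a) (.inr b)) ∧
      (∀ a b : Fin l, s (.inr a) (.inr b) ↔ τ a < τ b) then 1 else 0)
  refine ⟨c, fun n => ?_⟩
  rw [Fintype.card_sum, Fintype.card_fin, Fintype.card_fin] at hc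
  rw [← hc]
  refine Finset.sum_congr rfl fun π _ => ?_
  rw [occ_eq_sum, occ_eq_sum,
    ← Equiv.sum_comp (Equiv.sumArrowEquivProdArrow (Fin k) (Fin l) (Fin n)).symm,
    Fintype.sum_prod_type]
  push_cast
  rw [Finset.sum_mul_sum]
  exact Finset.sum_congr rfl fun f _ => Finset.sum_congr rfl fun g _ => by
    simp only [Equiv.sumArrowEquivProdArrow, Equiv.coe_fn_symm_mk, Sum.elim_inl, Sum.elim_inr]
    congr

/-- The number of entries of a list satisfying `P`. -/
def countOne (P : ℕ → Bool) : List ℕ → ℕ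
  | [] => 0
  | a :: l => (bif P a then 1 else 0) + countOne P l

/-- The number of subsequences of length two of a list satisfying `P`. -/
def countTwo (P : ℕ → ℕ → Bool) : List ℕ → ℕ
  | [] => 0
  | a :: l => countOne (P a) l + countTwo P l

/-- The number of subsequences of length three of a list satisfying `P`. -/
def countThree (P : ℕ → ℕ → ℕ → Bool) : List ℕ → ℕ
  | [] => 0
  | a :: l => countTwo (P a) l + countThree P l

theorem countOne_ofFn (P : ℕ → Bool) {n : ℕ} (v : Fin n → ℕ) :
    countOne P (List.ofFn v) = ∑ i, if P (v i) then 1 else 0 := by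
  induction n with
  | zero => simp [countOne]
  | succ n ih => simp [-Finset.sum_boole, List.ofFn_succ, countOne, ih, Fin.sum_univ_succ, cond_eq_ite]

theorem countTwo_ofFn (P : ℕ → ℕ → Bool) {n : ℕ} (v : Fin n → ℕ) :
    countTwo P (List.ofFn v) = ∑ i, ∑ j, if i < j ∧ P (v i) (v j) then 1 else 0 := by
  induction n with
  | zero => simp [countTwo]
  | succ n ih => simp [-Finset.sum_boole, List.ofFn_succ, countTwo, ih, Fin.sum_univ_succ, countOne_ofFn]

theorem countThree_ofFn (P : ℕ → ℕ → ℕ → Bool) {n : ℕ} (v : Fin n → ℕ) :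
    countThree P (List.ofFn v) =
      ∑ i, ∑ j, ∑ k, if i < j ∧ j < k ∧ P (v i) (v j) (v k) then 1 else 0 := by
  induction n with
  | zero => simp [countThree]
  | succ n ih => simp [-Finset.sum_boole, List.ofFn_succ, countThree, ih, Fin.sum_univ_succ, countTwo_ofFn]

/-- The sum of `F` over the permutations of `{0, …, n - 1}`, written as lists. -/
def sumPermList : (n : ℕ) → (List ℕ → ℕ) → ℕ
  | 0, F => F []
  | n + 1, F => sumPermList n fun l =>
      ((List.range (n + 1)).map fun p =>
        F (p :: l.map fun x => bif (x + 1).beq p then 0 else x + 1)).sum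

theorem sum_perm_ofFn (n : ℕ) (F : List ℕ → ℕ) :
    ∑ π : Equiv.Perm (Fin n), F (List.ofFn fun i => (π i : ℕ)) = sumPermList n F := by
  induction n generalizing F with
  | zero => simp [sumPermList]
  | succ n ih =>
    rw [sumPermList, ← ih, ← Equiv.sum_comp Equiv.Perm.decomposeFin.symm,
      Fintype.sum_prod_type_right]
    refine Finset.sum_congr rfl fun e _ => ?_
    rw [← List.sum_toFinset _ List.nodup_range, List.toFinset_range, Finset.sum_range]
    refine Finset.sum_congr rfl fun p _ => ?_
    congr 1
    rw [List.ofFn_succ, List.map_ofFn]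
    simp only [Equiv.Perm.decomposeFin_symm_apply_zero, Equiv.Perm.decomposeFin_symm_apply_succ]
    congr 2
    funext i
    rw [Equiv.swap_apply_def]
    simp only [Fin.ext_iff, Fin.val_succ, Function.comp,
      cond_eq_ite, Nat.beq_eq]
    split_ifs <;> simp_all

theorem occ_three {n : ℕ} (σ : Equiv.Perm (Fin 3)) (π : Equiv.Perm (Fin n)) :
    occ σ π = ∑ i, ∑ j, ∑ k, if i < j ∧ j < k ∧
      (∀ a b : Fin 3, π (![i, j, k] a) < π (![i, j, k] b) ↔ σ a < σ b) then 1 else 0 := by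
  rw [occ_eq_sum, ← (Fin.consEquiv fun _ => Fin n).sum_comp, Fintype.sum_prod_type]
  refine Finset.sum_congr rfl fun i _ => ?_
  rw [← (Fin.consEquiv fun _ => Fin n).sum_comp, Fintype.sum_prod_type]
  refine Finset.sum_congr rfl fun j _ => ?_
  rw [← (Equiv.funUnique (Fin 1) (Fin n)).symm.sum_comp]
  refine Finset.sum_congr rfl fun k _ => ?_
  have hf : (Fin.consEquiv fun _ => Fin n) (i, (Fin.consEquiv fun _ => Fin n)
      (j, (Equiv.funUnique (Fin 1) (Fin n)).symm k)) = ![i, j, k] := by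
    ext a
    fin_cases a <;> rfl
  rw [hf]
  simp only [← and_assoc (a := i < j)]
  refine if_congr (and_congr_left' ?_) rfl rfl
  simp [Fin.forall_fin_succ]
  grind

theorem occ_p123 {n : ℕ} (π : Equiv.Perm (Fin n)) :
    occ p123 π = countThree (fun a b c => a.blt b && b.blt c) (List.ofFn fun i => (π i : ℕ)) := by
  rw [occ_three, countThree_ofFn]
  congr! 9 with i _ j _ k _
  simp [Fin.forall_fin_succ, p123]
  grind

theorem occ_p132 {n : ℕ} (π : Equiv.Perm (Fin n)) :
    occ p132 π = countThree (fun a b c => a.blt c && c.blt b) (List.ofFn fun i => (π i : ℕ)) := by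
  rw [occ_three, countThree_ofFn]
  congr! 9 with i _ j _ k _
  simp [Fin.forall_fin_succ, p132, Equiv.swap_apply_def]
  grind

theorem sum_occ_p123 (n : ℕ) :
    ∑ π : Equiv.Perm (Fin n), (occ p123 π : ℚ) =
      sumPermList n (countThree fun a b c => a.blt b && b.blt c) := by
  rw [← sum_perm_ofFn]
  simp only [← occ_p123, Nat.cast_sum]

theorem sum_occ_p132 (n : ℕ) :
    ∑ π : Equiv.Perm (Fin n), (occ p132 π : ℚ) =
      sumPermList n (countThree fun a b c => a.blt c && c.blt b) := by
  rw [← sum_perm_ofFn]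
  simp only [← occ_p132, Nat.cast_sum]

theorem sum_occ_p123_mul_occ_p132 (n : ℕ) :
    ∑ π : Equiv.Perm (Fin n), (occ p123 π : ℚ) * occ p132 π =
      sumPermList n fun l => countThree (fun a b c => a.blt b && b.blt c) l *
        countThree (fun a b c => a.blt c && c.blt b) l := by
  rw [← sum_perm_ofFn]
  simp only [← occ_p123, ← occ_p132, Nat.cast_sum, Nat.cast_mul]

/-- A multiple of `n!` by a combination of `n.choose m`, `m ≤ 3`, is determined by its values
at `n ≤ 3`. -/
theorem eq_choose_three_div_six {S : ℕ → ℚ} {L : ℕ → ℕ} (hL : ∀ n, S n = L n)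
    {c : ℕ → ℚ}
    (hc : ∀ n, S n = n.factorial * ∑ m ∈ Finset.range 4, (n.choose m : ℚ) * c m)
    (h0 : L 0 = 0) (h1 : L 1 = 0) (h2 : L 2 = 0) (h3 : L 3 = 1) (n : ℕ) :
    S n = n.factorial * ((n.choose 3 : ℚ) / 6) := by
  have e0 := hc 0
  have e1 := hc 1
  have e2 := hc 2
  have e3 := hc 3
  rw [hL] at e0 e1 e2 e3
  simp [Finset.sum_range_succ, Nat.choose, Nat.factorial, h0, h1, h2, h3] at e0 e1 e2 e3
  have c0 : c 0 = 0 := by linarith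
  have c1 : c 1 = 0 := by linarith
  have c2 : c 2 = 0 := by linarith
  have c3 : c 3 = 1 / 6 := by linarith
  rw [hc]
  simp only [Finset.sum_range_succ, Finset.sum_range_zero, c0, c1, c2, c3]
  ring

theorem sum_occ_p123_eq (n : ℕ) :
    ∑ π : Equiv.Perm (Fin n), (occ p123 π : ℚ) = n.factorial * ((n.choose 3 : ℚ) / 6) := by
  obtain ⟨c, hc⟩ := exists_choose_expansion_occ p123
  exact eq_choose_three_div_six sum_occ_p123 hc
    (by decide +kernel) (by decide +kernel) (by decide +kernel) (by decide +kernel) n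

theorem sum_occ_p132_eq (n : ℕ) :
    ∑ π : Equiv.Perm (Fin n), (occ p132 π : ℚ) = n.factorial * ((n.choose 3 : ℚ) / 6) := by
  obtain ⟨c, hc⟩ := exists_choose_expansion_occ p132
  exact eq_choose_three_div_six sum_occ_p132 hc
    (by decide +kernel) (by decide +kernel) (by decide +kernel) (by decide +kernel) n

theorem sum_occ_p123_mul_occ_p132_eq (n : ℕ) :
    ∑ π : Equiv.Perm (Fin n), (occ p123 π : ℚ) * occ p132 π =
      n.factorial * ((n.choose 4 : ℚ) * (5 / 12) + n.choose 5 * (14 / 15) +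
        n.choose 6 * (5 / 9)) := by
  obtain ⟨c, hc⟩ := exists_choose_expansion_occ_mul_occ p123 p132
  have e0 := hc 0
  have e1 := hc 1
  have e2 := hc 2
  have e3 := hc 3
  have e4 := hc 4
  have e5 := hc 5
  have e6 := hc 6
  rw [sum_occ_p123_mul_occ_p132] at e0 e1 e2 e3 e4 e5 e6
  rw [show sumPermList 0 _ = 0 by decide +kernel] at e0
  rw [show sumPermList 1 _ = 0 by decide +kernel] at e1
  rw [show sumPermList 2 _ = 0 by decide +kernel] at e2
  rw [show sumPermList 3 _ = 0 by decide +kernel] at e3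
  rw [show sumPermList 4 _ = 10 by decide +kernel] at e4
  rw [show sumPermList 5 _ = 362 by decide +kernel] at e5
  rw [show sumPermList 6 _ = 8932 by decide +kernel] at e6
  simp [Finset.sum_range_succ, Nat.choose, Nat.factorial] at e0 e1 e2 e3 e4 e5 e6
  have c0 : c 0 = 0 := by linarith
  have c1 : c 1 = 0 := by linarith
  have c2 : c 2 = 0 := by linarith
  have c3 : c 3 = 0 := by linarith
  have c4 : c 4 = 5 / 12 := by linarith
  have c5 : c 5 = 14 / 15 := by linarith
  have c6 : c 6 = 5 / 9 := by linarith
  rw [hc]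
  simp [Finset.sum_range_succ, c0, c1, c2, c3, c4, c5, c6]

theorem cast_choose_succ (n m : ℕ) :
    (n.choose (m + 1) : ℚ) = n.choose m * ((n : ℚ) - m) / (m + 1) := by
  rw [eq_div_iff (by positivity)]
  rcases le_or_gt m n with h | h
  · rw [← Nat.cast_sub h]
    exact_mod_cast Nat.choose_succ_right_eq n m
  · simp [Nat.choose_eq_zero_of_lt h, Nat.choose_eq_zero_of_lt (h.trans (Nat.lt_succ_self m))]

theorem stmt5 (n : ℕ) (hn : 1 ≤ n) :
    (1 / (n.factorial : ℚ)) * ∑ π : Equiv.Perm (Fin n),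
        ((occ p123 π : ℚ) - (n.choose 3 : ℚ) / 6)
          * ((occ p132 π : ℚ) - (n.choose 3 : ℚ) / 6)
      = (n : ℚ) * ((n : ℚ) - 1) * ((n : ℚ) - 2)
        * (18 * (n : ℚ) ^ 2 - 51 * (n : ℚ) - 109) / 21600 := by
  have hfac : (n.factorial : ℚ) ≠ 0 := by positivity
  have hsum : ∑ π : Equiv.Perm (Fin n), ((occ p123 π : ℚ) - (n.choose 3 : ℚ) / 6)
        * ((occ p132 π : ℚ) - (n.choose 3 : ℚ) / 6) =
      n.factorial * ((n.choose 4 : ℚ) * (5 / 12) + n.choose 5 * (14 / 15) +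
        n.choose 6 * (5 / 9) - ((n.choose 3 : ℚ) / 6) ^ 2) := by
    simp only [sub_mul, mul_sub, Finset.sum_sub_distrib, ← Finset.mul_sum, ← Finset.sum_mul,
      sum_occ_p123_mul_occ_p132_eq, sum_occ_p123_eq, sum_occ_p132_eq, Finset.sum_const,
      Finset.card_univ, Fintype.card_perm, Fintype.card_fin, nsmul_eq_mul]
    ring
  rw [hsum, one_div, inv_mul_cancel_left₀ hfac]
  simp only [cast_choose_succ n 5, cast_choose_succ n 4, cast_choose_succ n 3,
    cast_choose_succ n 2, cast_choose_succ n 1, cast_choose_succ n 0, Nat.choose_zero_right]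
  push_cast
  ring
end
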